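/- For every integer n ≥ 0, q^{−n} ([2n+1 choose n]_q − [2n+1 choose n−1]_q) = ((1+q)/(1+q^{n+1})) · (1/[n+2]) [2n+2 choose n+1]_q in ℚ(q). -/

import Mathlib

open Finset

/-- The indeterminate `q`, viewed in the field `ℚ(q)` of rational functions. -/
noncomputable def q : RatFunc ℚ := RatFunc.X

/-- `[n] = (1 - q^n)/(1 - q)` in `ℚ(q)`. -/
noncomputable def qint (n : ℕ) : RatFunc ℚ := (1 - q ^ n) / (1 - q)

/-- The Gaussian binomial coefficient `[n choose k]_q` in `ℚ(q)`. -/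
noncomputable def qbinom (n k : ℤ) : RatFunc ℚ :=
  if 0 ≤ k ∧ k ≤ n then
    ∏ i ∈ Finset.range k.toNat, (1 - q ^ (n - k + (i : ℤ) + 1)) / (1 - q ^ ((i : ℤ) + 1))
  else if k = 0 then 1 else 0

/-- The `q`-Pochhammer symbol `(q; q)_m = ∏_{i=1}^m (1 - q^i)`. -/
noncomputable def qPoch (m : ℕ) : RatFunc ℚ := ∏ i ∈ Finset.range m, (1 - q ^ (i + 1))

theorem qPoch_succ (m : ℕ) : qPoch (m + 1) = qPoch m * (1 - q ^ (m + 1)) :=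
  Finset.prod_range_succ _ _

theorem q_ne_zero : q ≠ 0 := RatFunc.X_ne_zero

theorem q_pow_ne_C (c : ℚ) (m : ℕ) : q ^ (m + 1) ≠ RatFunc.C c := by
  intro h
  have h' : (Polynomial.X : Polynomial ℚ) ^ (m + 1) = Polynomial.C c := by
    apply RatFunc.algebraMap_injective ℚ
    simpa [q, RatFunc.algebraMap_X, RatFunc.algebraMap_C] using h
  simpa using congrArg Polynomial.natDegree h'

theorem one_sub_q_pow_ne_zero (m : ℕ) : 1 - q ^ (m + 1) ≠ 0 := fun h =>
  q_pow_ne_C 1 m (by rw [map_one]; exact (sub_eq_zero.mp h).symm)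

theorem one_add_q_pow_ne_zero (m : ℕ) : 1 + q ^ (m + 1) ≠ 0 := fun h =>
  q_pow_ne_C (-1) m (by rw [map_neg, map_one]; exact eq_neg_of_add_eq_zero_right h)

theorem qPoch_ne_zero (m : ℕ) : qPoch m ≠ 0 :=
  Finset.prod_ne_zero_iff.mpr fun i _ => one_sub_q_pow_ne_zero i

theorem qPoch_add (a b : ℕ) :
    qPoch (a + b) = qPoch a * ∏ i ∈ Finset.range b, (1 - q ^ (a + i + 1)) :=
  Finset.prod_range_add _ _ _

/-- The Gaussian binomial coefficient as a quotient of `q`-factorials. -/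
theorem qbinom_add (a b : ℕ) :
    qbinom ((a : ℤ) + b) b = qPoch (a + b) / (qPoch a * qPoch b) := by
  rw [qbinom, if_pos ⟨by omega, by omega⟩, qPoch_add, mul_div_mul_left _ _ (qPoch_ne_zero a),
    qPoch, ← Finset.prod_div_distrib, Int.toNat_natCast]
  refine Finset.prod_congr rfl fun i _ => ?_
  rw [show (a : ℤ) + b - b + i + 1 = ((a + i + 1 : ℕ) : ℤ) by push_cast; ring,
    show (i : ℤ) + 1 = ((i + 1 : ℕ) : ℤ) by push_cast; ring, zpow_natCast, zpow_natCast]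

theorem qbinom_eq {N K : ℤ} (a b : ℕ) (hN : N = a + b) (hK : K = b) :
    qbinom N K = qPoch (a + b) / (qPoch a * qPoch b) := by
  rw [hN, hK, qbinom_add]

theorem qbinom_of_neg {N K : ℤ} (hK : K < 0) : qbinom N K = 0 := by
  rw [qbinom, if_neg (by omega), if_neg (by omega)]

/-- The difference of two neighbouring Gaussian binomials just left of the centre. -/
theorem qbinom_sub_qbinom (n : ℕ) :
    qbinom (2 * n + 1) n - qbinom (2 * n + 1) ((n : ℤ) - 1) =
      q ^ n * (1 - q ^ 2) * qPoch (2 * n + 1) / (qPoch (n + 2) * qPoch n) := by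
  rw [qbinom_eq (n + 1) n (by push_cast; ring) rfl, show n + 1 + n = 2 * n + 1 by ring]
  have h₂ := one_sub_q_pow_ne_zero (n + 1)
  have hP := qPoch_ne_zero
  rcases n with _ | m
  · rw [qbinom_of_neg (by simp), qPoch_succ (0 + 1)]
    have := hP 0
    have := hP (0 + 1)
    field_simp
    ring
  · rw [qbinom_eq (m + 3) m (by push_cast; ring) (by push_cast; ring),
      show m + 3 + m = 2 * (m + 1) + 1 by ring, show m + 3 = m + 1 + 1 + 1 by ring,
      show m + 1 + 2 = m + 1 + 1 + 1 by ring, qPoch_succ (m + 1 + 1), qPoch_succ m]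
    have h₀ := one_sub_q_pow_ne_zero m
    have := hP m
    have := hP (m + 1 + 1)
    field_simp
    ring

theorem qCatalan_odd (n : ℕ) :
    q ^ (-(n : ℤ)) * (qbinom (2 * n + 1) n - qbinom (2 * n + 1) ((n : ℤ) - 1)) =
      ((1 + q) / (1 + q ^ (n + 1))) * ((1 / qint (n + 2)) * qbinom (2 * n + 2) (n + 1)) := by
  have hq : q ^ n ≠ 0 := pow_ne_zero n q_ne_zero
  have h₁ := one_sub_q_pow_ne_zero n
  have h₂ := one_sub_q_pow_ne_zero (n + 1)
  have h₃ := one_add_q_pow_ne_zero n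
  have h₄ : 1 - q ≠ 0 := by simpa using one_sub_q_pow_ne_zero 0
  have hP := qPoch_ne_zero n
  rw [qbinom_sub_qbinom, qbinom_eq (n + 1) (n + 1) (by push_cast; ring) (by push_cast; ring),
    show n + 1 + (n + 1) = 2 * n + 1 + 1 by ring, qPoch_succ (2 * n + 1), qPoch_succ (n + 1),
    qPoch_succ n, qint, zpow_neg, zpow_natCast,
    show 1 - q ^ (2 * n + 1 + 1) = (1 - q ^ (n + 1)) * (1 + q ^ (n + 1)) by ring,
    show n + 2 = n + 1 + 1 by ring, show 1 - q ^ 2 = (1 - q) * (1 + q) by ring]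
  field_simp
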